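/- Unimodality of the middle branch in the variance case: Let σ > 0 and β > 1 + σ², and define f_{2a}(p) = p(1 + σ² − p) / ( (β − p)(β + p − 1 − σ²) ) for p ∈ (0, 1 + σ²). Then f_{2a}'(p) ≥ 0 if and only if p ≤ (1 + σ²)/2; consequently f_{2a} is increasing on (0, (1+σ²)/2] and decreasing on [(1+σ²)/2, 1+σ²), with unique maximum location at p = (1+σ²)/2. -/

import Mathlib

open Set

/-- The normalized (`μ = 1`) middle branch
`f_{2a}(p) = p(1 + σ² − p)/((β − p)(β + p − 1 − σ²))` of the worst-case competitive
ratio under mean–variance–support information. -/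
noncomputable def f2a (σ β : ℝ) (p : ℝ) : ℝ :=
  p * (1 + σ ^ 2 - p) / ((β - p) * (β + p - 1 - σ ^ 2))

theorem f2a_lt_aux (σ β : ℝ) (hβ : 1 + σ ^ 2 < β) (p r : ℝ)
    (hp : p ∈ Ioo (0:ℝ) (1 + σ ^ 2)) (hr : r ∈ Ioo (0:ℝ) (1 + σ ^ 2))
    (h : 0 < (r - p) * (1 + σ ^ 2 - r - p)) : f2a σ β p < f2a σ β r := by
  obtain ⟨hp0, hp1⟩ := hp
  obtain ⟨hr0, hr1⟩ := hr
  have hc : 0 < β * (β - (1 + σ ^ 2)) := mul_pos (by linarith) (by linarith)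
  have hDp : 0 < (β - p) * (β + p - 1 - σ ^ 2) := mul_pos (by linarith) (by linarith)
  have hDr : 0 < (β - r) * (β + r - 1 - σ ^ 2) := mul_pos (by linarith) (by linarith)
  unfold f2a
  rw [div_lt_div_iff₀ hDp hDr]
  have := mul_pos hc h
  linear_combination this

theorem f2a_deriv_aux (σ β : ℝ) (hβ : 1 + σ ^ 2 < β) (p : ℝ)
    (hp : p ∈ Ioo (0:ℝ) (1 + σ ^ 2)) :
    deriv (f2a σ β) p = β * (β - (1 + σ ^ 2)) / ((β - p) * (β + p - 1 - σ ^ 2)) ^ 2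
      * (1 + σ ^ 2 - 2 * p) := by
  obtain ⟨hp0, hp1⟩ := hp
  have hDp : 0 < (β - p) * (β + p - 1 - σ ^ 2) := mul_pos (by linarith) (by linarith)
  have hx := hasDerivAt_id' p
  have hn := hx.mul (hx.const_sub (1 + σ ^ 2))
  have hd := (hx.const_sub β).mul (((hx.const_add β).sub_const 1).sub_const (σ ^ 2))
  have h := (hn.div hd hDp.ne').deriv
  refine Eq.trans h ?_
  simp only [Pi.mul_apply]
  rw [div_mul_eq_mul_div]
  congr 1
  ring

/-- **Unimodality of the middle branch in the variance case**: for `σ > 0` and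
`β > 1 + σ²`, on `(0, 1 + σ²)` the derivative of `f_{2a}` is non-negative iff
`p ≤ (1 + σ²)/2`; consequently `f_{2a}` is increasing on `(0,(1+σ²)/2]`, decreasing on
`[(1+σ²)/2, 1+σ²)`, and has its unique maximum location at `p = (1+σ²)/2`. -/
theorem f2a_unimodal (σ β : ℝ) (hσ : 0 < σ) (hβ : 1 + σ ^ 2 < β) :
    (∀ p ∈ Ioo (0:ℝ) (1 + σ ^ 2),
        (0 ≤ deriv (f2a σ β) p ↔ p ≤ (1 + σ ^ 2) / 2)) ∧
    StrictMonoOn (f2a σ β) (Ioc (0:ℝ) ((1 + σ ^ 2) / 2)) ∧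
    StrictAntiOn (f2a σ β) (Ico ((1 + σ ^ 2) / 2) (1 + σ ^ 2)) ∧
    (∀ p ∈ Ioo (0:ℝ) (1 + σ ^ 2), p ≠ (1 + σ ^ 2) / 2 →
        f2a σ β p < f2a σ β ((1 + σ ^ 2) / 2)) := by
  have hσ2 : 0 < σ ^ 2 := by positivity
  refine ⟨?_, ?_, ?_, ?_⟩
  · intro p hp
    rw [f2a_deriv_aux σ β hβ p hp]
    obtain ⟨hp0, hp1⟩ := hp
    have hc : 0 < β * (β - (1 + σ ^ 2)) := mul_pos (by linarith) (by linarith)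
    have hDp : 0 < (β - p) * (β + p - 1 - σ ^ 2) := mul_pos (by linarith) (by linarith)
    rw [mul_nonneg_iff_of_pos_left (div_pos hc (pow_pos hDp 2))]
    constructor <;> intro h <;> linarith
  · rintro p ⟨hp0, hp1⟩ r ⟨hr0, hr1⟩ hpr
    exact f2a_lt_aux σ β hβ p r ⟨hp0, by linarith⟩ ⟨hr0, by linarith⟩
      (mul_pos (by linarith) (by linarith))
  · rintro p ⟨hp0, hp1⟩ r ⟨hr0, hr1⟩ hpr
    exact f2a_lt_aux σ β hβ r p ⟨by linarith, by linarith⟩ ⟨by linarith, by linarith⟩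
      (mul_pos_of_neg_of_neg (by linarith) (by linarith))
  · intro p hp hne
    refine f2a_lt_aux σ β hβ p _ hp ⟨by linarith, by linarith⟩ ?_
    have h : 0 < ((1 + σ ^ 2) / 2 - p) ^ 2 := by
      have := sub_ne_zero.mpr hne.symm
      positivity
    linear_combination h
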